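/- arXiv:2307.06541 — 5 statements merged into one kernel-verified Lean document; each statement's English description precedes it below -/
import Mathlib

section
/- Let R₀, R̂ : S × A → ℝ be reward functions with 0 ≤ R₀(s,a) ≤ R_max and 0 ≤ R̂(s,a) ≤ R_max for all (s,a), where R_max > 0. Let γ₀, γ̂ ∈ (0,1) with γ̂ ≤ γ₀, let π₀ be a deterministic policy optimal for (R₀, γ₀), and let π̂ be a deterministic policy optimal for (R̂, γ̂). Then ‖V^{π₀}_{R₀,γ₀} − V^{π̂}_{R₀,γ₀}‖_∞ ≤ (2/(1−γ̂))·‖R₀ − R̂‖_∞ + ((γ₀ − γ̂)/((1−γ₀)(1−γ̂)))·R_max. -/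
/-!
Finite MDP setting. A deterministic policy is `π : S → A`; `V` is the value function
of `π` for reward `R` and discount `γ` iff it satisfies the Bellman equation
`V s = R s (π s) + γ * ∑ s', P s (π s) s' * V s'` (its unique solution for `γ < 1`).
`π` is optimal for `(R, γ)` if its value function dominates that of every
deterministic policy at every state. `‖·‖` on finite Pi types is the sup norm.
-/

namespace Stmt0

variable {S A : Type*}

/-- `P` is a transition kernel. -/
def IsKernel [Fintype S] (P : S → A → S → ℝ) : Prop :=
  (∀ s a s', 0 ≤ P s a s') ∧ ∀ s a, ∑ s', P s a s' = 1

/-- `V` is the value function of deterministic policy `π` under `(R, γ)`. -/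
def IsValue [Fintype S] (P : S → A → S → ℝ) (R : S → A → ℝ) (γ : ℝ) (π : S → A)
    (V : S → ℝ) : Prop :=
  ∀ s, V s = R s (π s) + γ * ∑ s', P s (π s) s' * V s'

/-- `π` is optimal for `(R, γ)`. -/
def IsOptimal [Fintype S] (P : S → A → S → ℝ) (R : S → A → ℝ) (γ : ℝ) (π : S → A) : Prop :=
  ∀ (π' : S → A) (V V' : S → ℝ), IsValue P R γ π V → IsValue P R γ π' V' → ∀ s, V' s ≤ V s

/-- A function satisfying `D ≤ c + γ P^π D` pointwise is bounded by `c / (1 - γ)`. -/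
lemma le_div_of_le_add_mul_sum [Fintype S] [Nonempty S] {P : S → A → S → ℝ} (hP : IsKernel P)
    {γ c : ℝ} (hγ0 : 0 ≤ γ) (hγ1 : γ < 1) (π : S → A) {D : S → ℝ}
    (hD : ∀ s, D s ≤ c + γ * ∑ s', P s (π s) s' * D s') (s : S) : D s ≤ c / (1 - γ) := by
  obtain ⟨m, hm⟩ := Finite.exists_max D
  have hsum : ∑ s', P m (π m) s' * D s' ≤ D m :=
    calc ∑ s', P m (π m) s' * D s' ≤ ∑ s', P m (π m) s' * D m :=
          Finset.sum_le_sum fun s' _ => mul_le_mul_of_nonneg_left (hm s') (hP.1 _ _ _)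
      _ = D m := by rw [← Finset.sum_mul, hP.2, one_mul]
  refine (hm s).trans ?_
  rw [le_div_iff₀ (by linarith)]
  linarith [hD m, mul_le_mul_of_nonneg_left hsum hγ0]

/-- Every deterministic policy has a value function when `0 ≤ γ < 1`. -/
lemma exists_isValue [Fintype S] [Nonempty S] {P : S → A → S → ℝ} (hP : IsKernel P)
    {γ : ℝ} (hγ0 : 0 ≤ γ) (hγ1 : γ < 1) (R : S → A → ℝ) (π : S → A) :
    ∃ V, IsValue P R γ π V := by
  let L : (S → ℝ) →ₗ[ℝ] (S → ℝ) :=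
    LinearMap.id - γ • Matrix.mulVecLin (Matrix.of fun s s' => P s (π s) s')
  have hL (V : S → ℝ) (s : S) : L V s = V s - γ * ∑ s', P s (π s) s' * V s' := by
    simp [L, Matrix.mulVec, dotProduct]
  have hle (V : S → ℝ) (hV : L V = 0) (s : S) : V s ≤ 0 := by
    simpa using le_div_of_le_add_mul_sum (c := 0) hP hγ0 hγ1 π
      (fun s => by linarith [hL V s, congrFun hV s, Pi.zero_apply (M := fun _ : S => ℝ) s]) s
  have hinj : Function.Injective L := by
    refine (injective_iff_map_eq_zero L).2 fun V hV => funext fun s => ?_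
    have hneg := hle (-V) (by rw [map_neg, hV, neg_zero]) s
    exact le_antisymm (hle V hV s) (by simpa using hneg)
  obtain ⟨V, hV⟩ := LinearMap.injective_iff_surjective.1 hinj fun s => R s (π s)
  exact ⟨V, fun s => by linarith [hL V s, congrFun hV s]⟩

/-- Value functions are nonnegative when the rewards are. -/
lemma IsValue.nonneg [Fintype S] [Nonempty S] {P : S → A → S → ℝ} (hP : IsKernel P)
    {R : S → A → ℝ} {γ : ℝ} (hγ0 : 0 ≤ γ) (hγ1 : γ < 1) {π : S → A} {V : S → ℝ}
    (hV : IsValue P R γ π V) (hR : ∀ s a, 0 ≤ R s a) (s : S) : 0 ≤ V s := by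
  have h := le_div_of_le_add_mul_sum (c := 0) (D := fun s => -V s) hP hγ0 hγ1 π
    (fun s => by
      simp only [mul_neg, Finset.sum_neg_distrib]
      linarith [hV s, hR s (π s)]) s
  simpa using h

/-- Value functions are bounded by `c / (1 - γ)` when the rewards are bounded by `c`. -/
lemma IsValue.le_div [Fintype S] [Nonempty S] {P : S → A → S → ℝ} (hP : IsKernel P)
    {R : S → A → ℝ} {γ c : ℝ} (hγ0 : 0 ≤ γ) (hγ1 : γ < 1) {π : S → A} {V : S → ℝ}
    (hV : IsValue P R γ π V) (hR : ∀ s a, R s a ≤ c) (s : S) : V s ≤ c / (1 - γ) :=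
  le_div_of_le_add_mul_sum hP hγ0 hγ1 π (fun s => by linarith [hV s, hR s (π s)]) s

theorem stmt0 [Fintype S] [Fintype A] [Nonempty S] [Nonempty A]
    (P : S → A → S → ℝ) (hP : IsKernel P)
    (Rmax : ℝ) (hRmax : 0 < Rmax)
    (R0 Rh : S → A → ℝ)
    (hR0 : ∀ s a, 0 ≤ R0 s a ∧ R0 s a ≤ Rmax)
    (hRh : ∀ s a, 0 ≤ Rh s a ∧ Rh s a ≤ Rmax)
    (γ0 γh : ℝ) (hγ01 : 0 < γ0) (hγ02 : γ0 < 1) (hγh1 : 0 < γh) (hγh2 : γh < 1)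
    (hγ : γh ≤ γ0)
    (π0 πh : S → A) (hπ0 : IsOptimal P R0 γ0 π0) (hπh : IsOptimal P Rh γh πh)
    (V0 Vh : S → ℝ) (hV0 : IsValue P R0 γ0 π0 V0) (hVh : IsValue P R0 γ0 πh Vh) :
    ‖(fun s => V0 s - Vh s : S → ℝ)‖ ≤
      2 / (1 - γh) * ‖(fun p : S × A => R0 p.1 p.2 - Rh p.1 p.2)‖
        + (γ0 - γh) / ((1 - γ0) * (1 - γh)) * Rmax := by
  set ε := ‖(fun p : S × A => R0 p.1 p.2 - Rh p.1 p.2)‖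
  have hε (s : S) (a : A) : |R0 s a - Rh s a| ≤ ε :=
    norm_le_pi_norm (fun p : S × A => R0 p.1 p.2 - Rh p.1 p.2) (s, a)
  obtain ⟨W0, hW0⟩ := exists_isValue hP hγh1.le hγh2 Rh π0
  obtain ⟨Wh, hWh⟩ := exists_isValue hP hγh1.le hγh2 Rh πh
  have hVh_nonneg := hVh.nonneg hP hγ01.le hγ02 fun s a => (hR0 s a).1
  have hV0_le := hV0.le_div hP hγ01.le hγ02 fun s a => (hR0 s a).2
  have hupper (s : S) :
      V0 s - W0 s ≤ (ε + (γ0 - γh) * (Rmax / (1 - γ0))) / (1 - γh) := by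
    refine le_div_of_le_add_mul_sum (D := fun s => V0 s - W0 s) hP hγh1.le hγh2 π0
      (fun s => ?_) s
    have hsum : ∑ s', P s (π0 s) s' * V0 s' ≤ Rmax / (1 - γ0) :=
      calc ∑ s', P s (π0 s) s' * V0 s' ≤ ∑ s', P s (π0 s) s' * (Rmax / (1 - γ0)) :=
            Finset.sum_le_sum fun s' _ => mul_le_mul_of_nonneg_left (hV0_le s') (hP.1 _ _ _)
        _ = Rmax / (1 - γ0) := by rw [← Finset.sum_mul, hP.2, one_mul]
    simp only [mul_sub, Finset.sum_sub_distrib]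
    linarith [hV0 s, hW0 s, (abs_le.1 (hε s (π0 s))).2,
      mul_le_mul_of_nonneg_left hsum (sub_nonneg.2 hγ)]
  have hlower (s : S) : Wh s - Vh s ≤ ε / (1 - γh) := by
    refine le_div_of_le_add_mul_sum (D := fun s => Wh s - Vh s) hP hγh1.le hγh2 πh
      (fun s => ?_) s
    have hsum : 0 ≤ ∑ s', P s (πh s) s' * Vh s' :=
      Finset.sum_nonneg fun s' _ => mul_nonneg (hP.1 _ _ _) (hVh_nonneg s')
    simp only [mul_sub, Finset.sum_sub_distrib]
    linarith [hVh s, hWh s, (abs_le.1 (hε s (πh s))).1, mul_nonneg (sub_nonneg.2 hγ) hsum]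
  have hγ0_ne : 1 - γ0 ≠ 0 := by linarith
  have hγh_ne : 1 - γh ≠ 0 := by linarith
  have hbound : 2 / (1 - γh) * ε + (γ0 - γh) / ((1 - γ0) * (1 - γh)) * Rmax =
      (ε + (γ0 - γh) * (Rmax / (1 - γ0))) / (1 - γh) + ε / (1 - γh) := by
    field_simp
    ring
  rw [hbound, pi_norm_le_iff_of_nonempty]
  intro s
  rw [Real.norm_of_nonneg (sub_nonneg.2 (hπ0 πh V0 Vh hV0 hVh s))]
  linarith [hupper s, hlower s, hπh π0 Wh W0 hWh hW0 s]

end Stmt0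
end

section
/- Let R₀, R̂ : S × A → ℝ be reward functions with values in [0, R_max], R_max > 0, let γ₀, γ̂ ∈ (0,1) with γ̂ ≤ γ₀, let N ≥ 1 be a natural number and C ≥ 1 a real number, and suppose ‖R₀ − R̂‖_∞ ≤ (R_max/(1−γ̂))·√((1/(2N))·ln C). Let π₀ be a deterministic policy optimal for (R₀, γ₀) and π̂ a deterministic policy optimal for (R̂, γ̂). Then ‖V^{π₀}_{R₀,γ₀} − V^{π̂}_{R₀,γ₀}‖_∞ ≤ (2·R_max/(1−γ̂)²)·√((1/(2N))·ln C) + ((γ₀ − γ̂)/((1−γ₀)(1−γ̂)))·R_max. -/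
/-!
Finite MDP setting. A deterministic policy is `π : S → A`; `V` is the value function
of `π` for reward `R` and discount `γ` iff it satisfies the Bellman equation
(its unique solution for `γ < 1`). `π` is optimal for `(R, γ)` if its value function
dominates that of every deterministic policy at every state. `‖·‖` on finite Pi
types is the sup norm.
-/

namespace Stmt1

variable {S A : Type*}

/-- `P` is a transition kernel. -/
def IsKernel [Fintype S] (P : S → A → S → ℝ) : Prop :=
  (∀ s a s', 0 ≤ P s a s') ∧ ∀ s a, ∑ s', P s a s' = 1

/-- `V` is the value function of deterministic policy `π` under `(R, γ)`. -/
def IsValue [Fintype S] (P : S → A → S → ℝ) (R : S → A → ℝ) (γ : ℝ) (π : S → A)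
    (V : S → ℝ) : Prop :=
  ∀ s, V s = R s (π s) + γ * ∑ s', P s (π s) s' * V s'

/-- `π` is optimal for `(R, γ)`. -/
def IsOptimal [Fintype S] (P : S → A → S → ℝ) (R : S → A → ℝ) (γ : ℝ) (π : S → A) : Prop :=
  ∀ (π' : S → A) (V V' : S → ℝ), IsValue P R γ π V → IsValue P R γ π' V' → ∀ s, V' s ≤ V s

/-- Comparison principle for a discounted kernel: a subsolution is bounded by `c / (1 - γ)`. -/
theorem le_div_of_le_add_discounted [Fintype S] {P : S → A → S → ℝ} (hP : IsKernel P)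
    {π : S → A} {γ c : ℝ} (hγ0 : 0 ≤ γ) (hγ1 : γ < 1) {U : S → ℝ}
    (hU : ∀ s, U s ≤ c + γ * ∑ s', P s (π s) s' * U s') (s : S) :
    U s ≤ c / (1 - γ) := by
  have : Nonempty S := ⟨s⟩
  obtain ⟨m, hm⟩ := Finite.exists_max U
  have hsum : ∑ s', P m (π m) s' * U s' ≤ U m := by
    calc ∑ s', P m (π m) s' * U s' ≤ ∑ s', P m (π m) s' * U m :=
          Finset.sum_le_sum fun s' _ => mul_le_mul_of_nonneg_left (hm s') (hP.1 _ _ _)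
      _ = U m := by rw [← Finset.sum_mul, hP.2, one_mul]
  refine (hm s).trans ?_
  rw [le_div_iff₀ (by linarith)]
  linarith [hU m, mul_le_mul_of_nonneg_left hsum hγ0]

/-- Every policy has a value function when the discount is below one. -/
theorem exists_isValue [Fintype S] {P : S → A → S → ℝ} (hP : IsKernel P)
    (R : S → A → ℝ) {γ : ℝ} (hγ0 : 0 ≤ γ) (hγ1 : γ < 1) (π : S → A) :
    ∃ V, IsValue P R γ π V := by
  let T : (S → ℝ) →ₗ[ℝ] (S → ℝ) :=
    LinearMap.id - γ • Matrix.mulVecLin (Matrix.of fun s s' => P s (π s) s')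
  have hT : ∀ V s, T V s = V s - γ * ∑ s', P s (π s) s' * V s' := fun V s => by
    simp [T, Matrix.mulVec, dotProduct]
  have nonpos : ∀ V, T V = 0 → ∀ s, V s ≤ 0 := fun V hV s => by
    have h := le_div_of_le_add_discounted hP (π := π) (c := 0) hγ0 hγ1 (U := V)
      (fun s => by
        have h := hT V s
        rw [hV, Pi.zero_apply] at h
        linarith) s
    simpa using h
  have hinj : Function.Injective T := by
    refine (injective_iff_map_eq_zero T).2 fun V hV => funext fun s => ?_
    have h := nonpos (-V) (by rw [map_neg, hV, neg_zero]) s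
    rw [Pi.neg_apply] at h
    exact le_antisymm (nonpos V hV s) (neg_nonpos.1 h)
  obtain ⟨V, hV⟩ := LinearMap.injective_iff_surjective.1 hinj fun s => R s (π s)
  refine ⟨V, fun s => ?_⟩
  have h := hT V s
  rw [hV] at h
  linarith

theorem IsValue.nonneg [Fintype S] {P : S → A → S → ℝ} (hP : IsKernel P) {R : S → A → ℝ}
    {γ : ℝ} (hγ0 : 0 ≤ γ) (hγ1 : γ < 1) {π : S → A} {V : S → ℝ}
    (hV : IsValue P R γ π V) (hR : ∀ s a, 0 ≤ R s a) (s : S) : 0 ≤ V s := by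
  have h := le_div_of_le_add_discounted hP (π := π) (c := 0) hγ0 hγ1 (U := fun s => -V s)
    (fun s => by
      simp only [mul_neg, Finset.sum_neg_distrib]
      linarith [hV s, hR s (π s)]) s
  rw [zero_div] at h
  linarith

theorem IsValue.le_div [Fintype S] {P : S → A → S → ℝ} (hP : IsKernel P) {R : S → A → ℝ}
    {γ M : ℝ} (hγ0 : 0 ≤ γ) (hγ1 : γ < 1) {π : S → A} {V : S → ℝ}
    (hV : IsValue P R γ π V) (hR : ∀ s a, R s a ≤ M) (s : S) : V s ≤ M / (1 - γ) :=
  le_div_of_le_add_discounted hP hγ0 hγ1 (fun s => by linarith [hV s, hR s (π s)]) s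

/-- Perturbing the reward by at most `ε` raises the value by at most `ε / (1 - γ)`. -/
theorem IsValue.sub_le_of_reward_le [Fintype S] {P : S → A → S → ℝ} (hP : IsKernel P)
    {R R' : S → A → ℝ} {γ ε : ℝ} (hγ0 : 0 ≤ γ) (hγ1 : γ < 1) {π : S → A} {V V' : S → ℝ}
    (hV : IsValue P R γ π V) (hV' : IsValue P R' γ π V')
    (hR : ∀ s a, R s a - R' s a ≤ ε) (s : S) : V s - V' s ≤ ε / (1 - γ) :=
  le_div_of_le_add_discounted hP (π := π) hγ0 hγ1 (U := fun s => V s - V' s) (fun s => by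
    simp only [mul_sub, Finset.sum_sub_distrib]
    linarith [hV s, hV' s, hR s (π s)]) s

/-- For nonnegative rewards the value is monotone in the discount. -/
theorem IsValue.mono_discount [Fintype S] {P : S → A → S → ℝ} (hP : IsKernel P)
    {R : S → A → ℝ} {γ γ' : ℝ} (hγ0 : 0 ≤ γ) (hγ : γ ≤ γ') (hγ1 : γ' < 1) {π : S → A}
    {V V' : S → ℝ} (hV : IsValue P R γ π V) (hV' : IsValue P R γ' π V')
    (hR : ∀ s a, 0 ≤ R s a) (s : S) : V s ≤ V' s := by
  have h := le_div_of_le_add_discounted hP (π := π) (c := 0) (hγ0.trans hγ) hγ1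
    (U := fun s => V s - V' s) (fun s => by
      have hsum : 0 ≤ ∑ s', P s (π s) s' * V s' := Finset.sum_nonneg fun s' _ =>
        mul_nonneg (hP.1 _ _ _) (hV.nonneg hP hγ0 (hγ.trans_lt hγ1) hR s')
      simp only [mul_sub, Finset.sum_sub_distrib]
      linarith [hV s, hV' s, mul_le_mul_of_nonneg_right hγ hsum]) s
  rw [zero_div] at h
  linarith

/-- Raising the discount from `γ` to `γ'` raises the value by at most
`(γ' - γ) / ((1 - γ') (1 - γ)) * M` for rewards bounded by `M`. -/
theorem IsValue.sub_le_of_discount_le [Fintype S] {P : S → A → S → ℝ} (hP : IsKernel P)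
    {R : S → A → ℝ} {γ γ' M : ℝ} (hγ0 : 0 ≤ γ) (hγ : γ ≤ γ') (hγ1 : γ' < 1) {π : S → A}
    {V V' : S → ℝ} (hV : IsValue P R γ π V) (hV' : IsValue P R γ' π V')
    (hR : ∀ s a, R s a ≤ M) (s : S) :
    V' s - V s ≤ (γ' - γ) / ((1 - γ') * (1 - γ)) * M := by
  have h := le_div_of_le_add_discounted hP (π := π) (c := (γ' - γ) * (M / (1 - γ)))
    (hγ0.trans hγ) hγ1 (U := fun s => V' s - V s) (fun s => by
      have hsum : ∑ s', P s (π s) s' * V s' ≤ M / (1 - γ) := by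
        calc ∑ s', P s (π s) s' * V s' ≤ ∑ s', P s (π s) s' * (M / (1 - γ)) :=
              Finset.sum_le_sum fun s' _ => mul_le_mul_of_nonneg_left
                (hV.le_div hP hγ0 (hγ.trans_lt hγ1) hR s') (hP.1 _ _ _)
          _ = M / (1 - γ) := by rw [← Finset.sum_mul, hP.2, one_mul]
      simp only [mul_sub, Finset.sum_sub_distrib]
      linarith [hV s, hV' s, mul_le_mul_of_nonneg_left hsum (sub_nonneg.2 hγ)]) s
  convert h using 1
  have h1 : 1 - γ' ≠ 0 := by linarith
  have h2 : 1 - γ ≠ 0 := by linarith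
  field_simp

theorem stmt1 [Fintype S] [Fintype A] [Nonempty S] [Nonempty A]
    (P : S → A → S → ℝ) (hP : IsKernel P)
    (Rmax : ℝ) (hRmax : 0 < Rmax)
    (R0 Rh : S → A → ℝ)
    (hR0 : ∀ s a, 0 ≤ R0 s a ∧ R0 s a ≤ Rmax)
    (hRh : ∀ s a, 0 ≤ Rh s a ∧ Rh s a ≤ Rmax)
    (γ0 γh : ℝ) (hγ01 : 0 < γ0) (hγ02 : γ0 < 1) (hγh1 : 0 < γh) (hγh2 : γh < 1)
    (hγ : γh ≤ γ0)
    (N : ℕ) (hN : 1 ≤ N) (C : ℝ) (hC : 1 ≤ C)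
    (hRbound : ‖(fun p : S × A => R0 p.1 p.2 - Rh p.1 p.2)‖ ≤
      Rmax / (1 - γh) * Real.sqrt (1 / (2 * N) * Real.log C))
    (π0 πh : S → A) (hπ0 : IsOptimal P R0 γ0 π0) (hπh : IsOptimal P Rh γh πh)
    (V0 Vh : S → ℝ) (hV0 : IsValue P R0 γ0 π0 V0) (hVh : IsValue P R0 γ0 πh Vh) :
    ‖(fun s => V0 s - Vh s : S → ℝ)‖ ≤
      2 * Rmax / (1 - γh) ^ 2 * Real.sqrt (1 / (2 * N) * Real.log C)
        + (γ0 - γh) / ((1 - γ0) * (1 - γh)) * Rmax := by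
  have hγh0 := hγh1.le
  set ε := Rmax / (1 - γh) * Real.sqrt (1 / (2 * N) * Real.log C) with hε
  have hR : ∀ s a, |R0 s a - Rh s a| ≤ ε := fun s a =>
    (norm_le_pi_norm (fun p : S × A => R0 p.1 p.2 - Rh p.1 p.2) (s, a)).trans hRbound
  obtain ⟨W0, hW0⟩ := exists_isValue hP R0 hγh0 hγh2 π0
  obtain ⟨Wh, hWh⟩ := exists_isValue hP R0 hγh0 hγh2 πh
  obtain ⟨X0, hX0⟩ := exists_isValue hP Rh hγh0 hγh2 π0
  obtain ⟨Xh, hXh⟩ := exists_isValue hP Rh hγh0 hγh2 πh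
  have hbound : 2 * Rmax / (1 - γh) ^ 2 * Real.sqrt (1 / (2 * N) * Real.log C) =
      ε / (1 - γh) + ε / (1 - γh) := by
    have h : 1 - γh ≠ 0 := by linarith
    rw [hε]
    field_simp
    ring
  have hnonneg : ∀ s, 0 ≤ V0 s - Vh s := fun s => sub_nonneg.2 (hπ0 πh V0 Vh hV0 hVh s)
  have hle : ∀ s, V0 s - Vh s ≤ ε / (1 - γh) + ε / (1 - γh)
      + (γ0 - γh) / ((1 - γ0) * (1 - γh)) * Rmax := fun s => by
    linarith [hW0.sub_le_of_discount_le hP hγh0 hγ hγ02 hV0 (fun s a => (hR0 s a).2) s,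
      hW0.sub_le_of_reward_le hP hγh0 hγh2 hX0 (fun s a => (abs_le.1 (hR s a)).2) s,
      hπh π0 Xh X0 hXh hX0 s,
      hXh.sub_le_of_reward_le (ε := ε) hP hγh0 hγh2 hWh
        (fun s a => by linarith [(abs_le.1 (hR s a)).1]) s,
      hWh.mono_discount hP hγh0 hγ hγ02 hVh (fun s a => (hR0 s a).1) s]
  rw [hbound]
  refine (pi_norm_le_iff_of_nonempty _).2 fun s => ?_
  rw [Real.norm_of_nonneg (hnonneg s)]
  exact hle s

end Stmt1
end

section
/- Let R : S × A → ℝ be a reward function with 0 ≤ R(s,a) ≤ R_max for all (s,a), where R_max > 0, and let γ̂, γ₀ ∈ [0,1) with γ̂ ≤ γ₀. Then for every deterministic policy π and every state s: V^π_{R,γ̂}(s) ≤ V^π_{R,γ₀}(s) ≤ V^π_{R,γ̂}(s) + ((γ₀ − γ̂)/((1−γ₀)(1−γ̂)))·R_max. -/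
/-!
Finite MDP setting. A deterministic policy is `π : S → A`; `V` is the value function
of `π` for reward `R` and discount `γ` iff it satisfies the Bellman equation
(its unique solution for `γ < 1`).
-/

namespace Stmt2

variable {S A : Type*}

/-- `P` is a transition kernel. -/
def IsKernel [Fintype S] (P : S → A → S → ℝ) : Prop :=
  (∀ s a s', 0 ≤ P s a s') ∧ ∀ s a, ∑ s', P s a s' = 1

/-- `V` is the value function of deterministic policy `π` under `(R, γ)`. -/
def IsValue [Fintype S] (P : S → A → S → ℝ) (R : S → A → ℝ) (γ : ℝ) (π : S → A)
    (V : S → ℝ) : Prop :=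
  ∀ s, V s = R s (π s) + γ * ∑ s', P s (π s) s' * V s'

/-- Minimum principle: a function dominating its discounted one-step average is nonnegative. -/
theorem nonneg_of_discounted_average_le [Fintype S] [Nonempty S] {Q : S → S → ℝ}
    (hQ : ∀ s s', 0 ≤ Q s s') (hQ1 : ∀ s, ∑ s', Q s s' = 1) {γ : ℝ} (hγ0 : 0 ≤ γ) (hγ1 : γ < 1)
    {U : S → ℝ} (hU : ∀ s, γ * ∑ s', Q s s' * U s' ≤ U s) (s : S) : 0 ≤ U s := by
  obtain ⟨m, hm⟩ := Finite.exists_min U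
  refine le_trans ?_ (hm s)
  have havg : U m ≤ ∑ s', Q m s' * U s' := by
    calc U m = ∑ s', Q m s' * U m := by rw [← Finset.sum_mul, hQ1, one_mul]
      _ ≤ ∑ s', Q m s' * U s' :=
        Finset.sum_le_sum fun s' _ => mul_le_mul_of_nonneg_left (hm s') (hQ m s')
  nlinarith [hU m, mul_le_mul_of_nonneg_left havg hγ0]

theorem stmt2 [Fintype S] [Fintype A] [Nonempty S] [Nonempty A]
    (P : S → A → S → ℝ) (hP : IsKernel P)
    (Rmax : ℝ) (hRmax : 0 < Rmax)
    (R : S → A → ℝ) (hR : ∀ s a, 0 ≤ R s a ∧ R s a ≤ Rmax)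
    (γh γ0 : ℝ) (hγh1 : 0 ≤ γh) (hγh2 : γh < 1) (hγ01 : 0 ≤ γ0) (hγ02 : γ0 < 1)
    (hγ : γh ≤ γ0)
    (π : S → A) (Vh V0 : S → ℝ)
    (hVh : IsValue P R γh π Vh) (hV0 : IsValue P R γ0 π V0) :
    ∀ s, Vh s ≤ V0 s ∧ V0 s ≤ Vh s + (γ0 - γh) / ((1 - γ0) * (1 - γh)) * Rmax := by
  have hQ s s' : 0 ≤ P s (π s) s' := hP.1 s (π s) s'
  have hQ1 s : ∑ s', P s (π s) s' = 1 := hP.2 s (π s)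
  have hpos : ∀ s, 0 ≤ Vh s := nonneg_of_discounted_average_le hQ hQ1 hγh1 hγh2 fun s => by
    linarith [hVh s, (hR s (π s)).1]
  set b := Rmax / (1 - γh) with hb
  have hbeq : b * (1 - γh) = Rmax := div_mul_cancel₀ _ (by linarith)
  have hle : ∀ s, 0 ≤ b - Vh s := nonneg_of_discounted_average_le hQ hQ1 hγh1 hγh2 fun s => by
    simp only [mul_sub, Finset.sum_sub_distrib, ← Finset.sum_mul, hQ1]
    linarith [hVh s, (hR s (π s)).2]
  have havg_pos s : 0 ≤ ∑ s', P s (π s) s' * Vh s' :=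
    Finset.sum_nonneg fun s' _ => mul_nonneg (hQ s s') (hpos s')
  have havg_le s : ∑ s', P s (π s) s' * Vh s' ≤ b := by
    calc ∑ s', P s (π s) s' * Vh s' ≤ ∑ s', P s (π s) s' * b :=
          Finset.sum_le_sum fun s' _ =>
            mul_le_mul_of_nonneg_left (sub_nonneg.1 (hle s')) (hQ s s')
      _ = b := by rw [← Finset.sum_mul, hQ1, one_mul]
  set c := (γ0 - γh) / ((1 - γ0) * (1 - γh)) * Rmax with hc
  have hceq : c * (1 - γ0) = (γ0 - γh) * b := by
    have h0 : 1 - γ0 ≠ 0 := by linarith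
    have h1 : 1 - γh ≠ 0 := by linarith
    rw [hc, hb]
    field_simp
  have hlower : ∀ s, 0 ≤ V0 s - Vh s :=
    nonneg_of_discounted_average_le hQ hQ1 hγ01 hγ02 fun s => by
      simp only [mul_sub, Finset.sum_sub_distrib]
      linarith [hVh s, hV0 s, mul_nonneg (sub_nonneg.2 hγ) (havg_pos s)]
  have hupper : ∀ s, 0 ≤ Vh s + c - V0 s :=
    nonneg_of_discounted_average_le hQ hQ1 hγ01 hγ02 fun s => by
      simp only [mul_sub, mul_add, Finset.sum_sub_distrib, Finset.sum_add_distrib,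
        ← Finset.sum_mul, hQ1]
      linarith [hVh s, hV0 s, mul_le_mul_of_nonneg_left (havg_le s) (sub_nonneg.2 hγ)]
  exact fun s => ⟨sub_nonneg.1 (hlower s), sub_nonneg.1 (hupper s)⟩

end Stmt2
end

section
/- Let π^E be a stochastic policy and γ̂ ∈ (0,1). A reward function R : S × A → ℝ has the property that π^E is optimal for (R, γ̂) if and only if there exist a function ζ : S × A → ℝ with ζ(s,a) ≥ 0 for all (s,a) and a function V : S → ℝ such that R = −B̄^{π^E}ζ + (E − γ̂P)V, i.e., R(s,a) = −ζ(s,a)·1[π^E(a|s) = 0] + V(s) − γ̂·∑_{s'} P(s'|s,a)·V(s') for all (s,a). -/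
/-!
Feasible reward function set (Lemma: characterization). `π^E` is optimal for
`(R, γ̂)` iff `R = -B̄^{π^E} ζ + (E - γ̂ P) V` for some `ζ ≥ 0` and `V : S → ℝ`.
A stochastic policy assigns a probability distribution over actions to each state;
`Q` is the Q-function of `π` under `(R, γ)` iff it satisfies the Bellman equation
(its unique solution for `γ < 1`), and `V^π(s) = ∑ₐ π(a|s) Q(s,a)`. `π` is optimal
if its value function dominates that of every stochastic policy at every state.
-/

namespace Stmt6

variable {S A : Type*}

/-- `P` is a transition kernel. -/
def IsKernel [Fintype S] (P : S → A → S → ℝ) : Prop :=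
  (∀ s a s', 0 ≤ P s a s') ∧ ∀ s a, ∑ s', P s a s' = 1

/-- `π` is a stochastic policy. -/
def IsPolicy [Fintype A] (π : S → A → ℝ) : Prop :=
  (∀ s a, 0 ≤ π s a) ∧ ∀ s, ∑ a, π s a = 1

/-- `Q` is the Q-function of stochastic policy `π` under `(R, γ)`. -/
def IsQ [Fintype S] [Fintype A] (P : S → A → S → ℝ) (R : S → A → ℝ) (γ : ℝ)
    (π : S → A → ℝ) (Q : S → A → ℝ) : Prop :=
  ∀ s a, Q s a = R s a + γ * ∑ s', P s a s' * ∑ a', π s' a' * Q s' a'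

/-- The value function obtained from a stochastic policy `π` and a Q-function `Q`. -/
def Vof [Fintype A] (π : S → A → ℝ) (Q : S → A → ℝ) (s : S) : ℝ :=
  ∑ a, π s a * Q s a

/-- The stochastic policy `π` is optimal for `(R, γ)`. -/
def IsOptimal [Fintype S] [Fintype A] (P : S → A → S → ℝ) (R : S → A → ℝ) (γ : ℝ)
    (π : S → A → ℝ) : Prop :=
  ∀ π' : S → A → ℝ, IsPolicy π' → ∀ Q Q' : S → A → ℝ,
    IsQ P R γ π Q → IsQ P R γ π' Q' → ∀ s, Vof π' Q' s ≤ Vof π Q s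

/-- A function dominated by its own discounted expectation is nonpositive. -/
theorem nonpos_of_le_discounted [Fintype S] [Fintype A] {P : S → A → S → ℝ} (hP : IsKernel P)
    {π : S → A → ℝ} (hπ : IsPolicy π) {γ : ℝ} (h0 : 0 < γ) (h1 : γ < 1) {D : S → ℝ}
    (hD : ∀ s, D s ≤ ∑ a, π s a * (γ * ∑ s', P s a s' * D s')) (s : S) : D s ≤ 0 := by
  have : Nonempty S := ⟨s⟩
  obtain ⟨m, hm⟩ := Finite.exists_max D
  have hexp : ∀ a, ∑ s', P m a s' * D s' ≤ D m := fun a =>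
    calc ∑ s', P m a s' * D s' ≤ ∑ s', P m a s' * D m :=
          Finset.sum_le_sum fun s' _ => mul_le_mul_of_nonneg_left (hm s') (hP.1 m a s')
      _ = D m := by rw [← Finset.sum_mul, hP.2, one_mul]
  have hle : ∑ a, π m a * (γ * ∑ s', P m a s' * D s') ≤ γ * D m :=
    calc ∑ a, π m a * (γ * ∑ s', P m a s' * D s') ≤ ∑ a, π m a * (γ * D m) :=
          Finset.sum_le_sum fun a _ => mul_le_mul_of_nonneg_left
            (mul_le_mul_of_nonneg_left (hexp a) h0.le) (hπ.1 m a)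
      _ = γ * D m := by rw [← Finset.sum_mul, hπ.2, one_mul]
  have := hD m
  have := hm s
  nlinarith

/-- Every stochastic policy has a Q-function. -/
theorem exists_isQ [Fintype S] [Fintype A] {P : S → A → S → ℝ} (hP : IsKernel P)
    {π : S → A → ℝ} (hπ : IsPolicy π) {γ : ℝ} (h0 : 0 < γ) (h1 : γ < 1) (R : S → A → ℝ) :
    ∃ Q, IsQ P R γ π Q := by
  let L : (S → ℝ) →ₗ[ℝ] (S → ℝ) :=
    { toFun := fun V s => V s - ∑ a, π s a * (γ * ∑ s', P s a s' * V s')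
      map_add' := fun V W => by
        ext s
        simp only [Pi.add_apply, mul_add, Finset.sum_add_distrib]
        ring
      map_smul' := fun c V => by
        ext s
        simp only [Pi.smul_apply, smul_eq_mul, RingHom.id_apply, mul_sub, Finset.mul_sum]
        congr 1
        refine Finset.sum_congr rfl fun a _ => Finset.sum_congr rfl fun s' _ => ?_
        ring }
  have hL : Function.Injective L := by
    rw [injective_iff_map_eq_zero]
    intro V hV
    have hV' : ∀ s, V s = ∑ a, π s a * (γ * ∑ s', P s a s' * V s') := fun s =>
      sub_eq_zero.mp (congrFun hV s)
    ext s
    refine le_antisymm (nonpos_of_le_discounted hP hπ h0 h1 (fun s => (hV' s).le) s) ?_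
    have := nonpos_of_le_discounted hP hπ h0 h1 (D := fun s => -V s) (fun s => by
      simpa only [mul_neg, Finset.sum_neg_distrib] using (congrArg Neg.neg (hV' s)).le) s
    simpa using this
  obtain ⟨V, hV⟩ := LinearMap.surjective_of_injective hL (fun s => ∑ a, π s a * R s a)
  have hV' : ∀ s, ∑ a, π s a * (R s a + γ * ∑ s', P s a s' * V s') = V s := fun s => by
    have h : V s - ∑ a, π s a * (γ * ∑ s', P s a s' * V s') = ∑ a, π s a * R s a :=
      congrFun hV s
    simp only [mul_add, Finset.sum_add_distrib]
    linarith
  exact ⟨fun s a => R s a + γ * ∑ s', P s a s' * V s', fun s a => by simp only [hV']⟩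

/-- The value of `π` exceeds `W` by the one-step advantage of `π` over `W`, plus the discounted
expected future excess. -/
theorem vof_sub_eq [Fintype S] [Fintype A] {P : S → A → S → ℝ} {R : S → A → ℝ} {γ : ℝ}
    {π Q : S → A → ℝ} (hπ : IsPolicy π) (hQ : IsQ P R γ π Q) (W : S → ℝ) (s : S) :
    Vof π Q s - W s = ∑ a, π s a * (R s a + γ * ∑ s', P s a s' * W s' - W s)
      + ∑ a, π s a * (γ * ∑ s', P s a s' * (Vof π Q s' - W s')) := by
  have hW : W s = ∑ a, π s a * W s := by rw [← Finset.sum_mul, hπ.2, one_mul]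
  have hV : Vof π Q s = ∑ a, π s a * (R s a + γ * ∑ s', P s a s' * Vof π Q s') :=
    Finset.sum_congr rfl fun a _ => congrArg (π s a * ·) (hQ s a)
  rw [hV]
  nth_rewrite 1 [hW]
  rw [← Finset.sum_sub_distrib, ← Finset.sum_add_distrib]
  refine Finset.sum_congr rfl fun a _ => ?_
  simp only [mul_sub, Finset.sum_sub_distrib]
  ring

/-- A policy with nonpositive one-step advantage over `W` has value at most `W`. -/
theorem vof_le_of_advantage_nonpos [Fintype S] [Fintype A] {P : S → A → S → ℝ}
    (hP : IsKernel P) {R : S → A → ℝ} {γ : ℝ} (h0 : 0 < γ) (h1 : γ < 1) {π Q : S → A → ℝ}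
    (hπ : IsPolicy π) (hQ : IsQ P R γ π Q) {W : S → ℝ}
    (hW : ∀ s, ∑ a, π s a * (R s a + γ * ∑ s', P s a s' * W s' - W s) ≤ 0) (s : S) :
    Vof π Q s ≤ W s := by
  have := nonpos_of_le_discounted hP hπ h0 h1 (D := fun s => Vof π Q s - W s) (fun s => by
    have := vof_sub_eq hπ hQ W s
    have := hW s
    linarith) s
  linarith

/-- A policy with nonnegative one-step advantage over `W` has value at least `W`. -/
theorem le_vof_of_advantage_nonneg [Fintype S] [Fintype A] {P : S → A → S → ℝ}
    (hP : IsKernel P) {R : S → A → ℝ} {γ : ℝ} (h0 : 0 < γ) (h1 : γ < 1) {π Q : S → A → ℝ}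
    (hπ : IsPolicy π) (hQ : IsQ P R γ π Q) {W : S → ℝ}
    (hW : ∀ s, 0 ≤ ∑ a, π s a * (R s a + γ * ∑ s', P s a s' * W s' - W s)) (s : S) :
    W s ≤ Vof π Q s := by
  have := nonpos_of_le_discounted hP hπ h0 h1 (D := fun s => -(Vof π Q s - W s)) (fun s => by
    simp only [mul_neg, Finset.sum_neg_distrib]
    have := vof_sub_eq hπ hQ W s
    have := hW s
    linarith) s
  linarith

/-- No action improves on an optimal policy in one step. -/
theorem IsOptimal.le_vof [Fintype S] [Fintype A] {P : S → A → S → ℝ} (hP : IsKernel P)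
    {R : S → A → ℝ} {γ : ℝ} (h0 : 0 < γ) (h1 : γ < 1) {π Q : S → A → ℝ}
    (hopt : IsOptimal P R γ π) (hπ : IsPolicy π) (hQ : IsQ P R γ π Q) (s : S) (a : A) :
    Q s a ≤ Vof π Q s := by
  classical
  by_contra! hlt
  let π' : S → A → ℝ := Function.update π s (Pi.single a 1)
  have hπ's : π' s = Pi.single a 1 := Function.update_self ..
  have hπ'ne : ∀ t, t ≠ s → π' t = π t := fun t ht => Function.update_of_ne ht ..
  have hπ' : IsPolicy π' := by
    refine ⟨fun t b => ?_, fun t => ?_⟩ <;> rcases eq_or_ne t s with rfl | ht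
    · rw [hπ's, Pi.single_apply]
      split_ifs <;> norm_num
    · rw [hπ'ne t ht]
      exact hπ.1 t b
    · simp [hπ's]
    · rw [hπ'ne t ht]
      exact hπ.2 t
  obtain ⟨Q', hQ'⟩ := exists_isQ hP hπ' h0 h1 R
  have hadv : ∀ t b, R t b + γ * ∑ s', P t b s' * Vof π Q s' - Vof π Q t
      = Q t b - Vof π Q t := fun t b => congrArg (· - Vof π Q t) (hQ t b).symm
  have hs : ∑ b, π' s b * (Q s b - Vof π Q s) = Q s a - Vof π Q s := by
    simp [hπ's, Pi.single_apply]
  have hge := le_vof_of_advantage_nonneg hP h0 h1 hπ' hQ' (W := Vof π Q) (fun t => by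
    simp only [hadv]
    rcases eq_or_ne t s with rfl | ht
    · linarith
    · rw [hπ'ne t ht]
      simp only [mul_sub, Finset.sum_sub_distrib, ← Finset.sum_mul, hπ.2, one_mul]
      exact (sub_self (Vof π Q t)).ge)
  have heq := vof_sub_eq hπ' hQ' (Vof π Q) s
  simp only [hadv, hs] at heq
  have hfut : 0 ≤ ∑ b, π' s b * (γ * ∑ s', P s b s' * (Vof π' Q' s' - Vof π Q s')) :=
    Finset.sum_nonneg fun b _ => mul_nonneg (hπ'.1 s b) <| mul_nonneg h0.le <|
      Finset.sum_nonneg fun s' _ => mul_nonneg (hP.1 s b s') (sub_nonneg.mpr (hge s'))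
  have := hopt π' hπ' Q Q' hQ hQ' s
  linarith

theorem stmt6 [Fintype S] [Fintype A] [Nonempty S] [Nonempty A]
    (P : S → A → S → ℝ) (hP : IsKernel P)
    (πE : S → A → ℝ) (hπE : IsPolicy πE)
    (γh : ℝ) (hγh1 : 0 < γh) (hγh2 : γh < 1)
    (R : S → A → ℝ) :
    IsOptimal P R γh πE ↔
      ∃ ζ : S → A → ℝ, (∀ s a, 0 ≤ ζ s a) ∧ ∃ V : S → ℝ,
        ∀ s a, R s a = -(ζ s a * (if πE s a = 0 then 1 else 0))
          + (V s - γh * ∑ s', P s a s' * V s') := by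
  constructor
  · intro hopt
    obtain ⟨Q, hQ⟩ := exists_isQ hP hπE hγh1 hγh2 R
    have hle := hopt.le_vof hP hγh1 hγh2 hπE hQ
    refine ⟨fun s a => Vof πE Q s - Q s a, fun s a => sub_nonneg.mpr (hle s a),
      Vof πE Q, fun s a => ?_⟩
    have hR : Q s a = R s a + γh * ∑ s', P s a s' * Vof πE Q s' := hQ s a
    split_ifs with h
    · linarith
    · have hsum : ∑ b, πE s b * (Vof πE Q s - Q s b) = 0 := by
        simp only [mul_sub, Finset.sum_sub_distrib, ← Finset.sum_mul, hπE.2, one_mul]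
        exact sub_self (Vof πE Q s)
      have hzero := (Finset.sum_eq_zero_iff_of_nonneg fun b _ =>
        mul_nonneg (hπE.1 s b) (sub_nonneg.mpr (hle s b))).mp hsum a (Finset.mem_univ a)
      have := (mul_eq_zero.mp hzero).resolve_left h
      linarith
  · rintro ⟨ζ, hζ, V, hR⟩ π' hπ' Q Q' hQ hQ' s
    have hadv : ∀ s a, R s a + γh * ∑ s', P s a s' * V s' - V s
        = -(ζ s a * (if πE s a = 0 then 1 else 0)) := fun s a => by
      rw [hR s a]
      ring
    refine (vof_le_of_advantage_nonpos hP hγh1 hγh2 hπ' hQ' (W := V) (fun s => ?_) s).trans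
      (le_vof_of_advantage_nonneg hP hγh1 hγh2 hπE hQ (W := V) (fun s => ?_) s)
    · simp only [hadv]
      refine Finset.sum_nonpos fun a _ =>
        mul_nonpos_of_nonneg_of_nonpos (hπ'.1 s a) (neg_nonpos.mpr (mul_nonneg (hζ s a) ?_))
      split_ifs <;> norm_num
    · simp only [hadv]
      refine Finset.sum_nonneg fun a _ => ?_
      split_ifs with h <;> simp [h]

end Stmt6
end

section
/- Let π^E be a stochastic policy, and let Q : S × A → ℝ be any function; write V(s) = ∑_a π^E(a|s)·Q(s,a). Then the following two conditions hold — (i) Q(s,a) = V(s) whenever π^E(a|s) > 0, and (ii) Q(s,a) ≤ V(s) whenever π^E(a|s) = 0 — if and only if there exist ζ : S × A → ℝ with ζ ≥ 0 pointwise and W : S → ℝ such that Q = −B̄^{π^E}ζ + EW, i.e., Q(s,a) = −ζ(s,a)·1[π^E(a|s) = 0] + W(s) for all (s,a). -/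
/-!
Advantage-function characterization: given a stochastic policy `π^E` and any
`Q : S × A → ℝ` with `V(s) = ∑ₐ π^E(a|s) Q(s,a)`, the two optimality conditions
(`Q(s,a) = V(s)` when `π^E(a|s) > 0`, and `Q(s,a) ≤ V(s)` when `π^E(a|s) = 0`)
hold iff `Q = -B̄^{π^E} ζ + E W` for some pointwise-nonnegative `ζ` and `W : S → ℝ`.
-/

namespace Stmt7

variable {S A : Type*}

/-- `π` is a stochastic policy. -/
def IsPolicy [Fintype A] (π : S → A → ℝ) : Prop :=
  (∀ s a, 0 ≤ π s a) ∧ ∀ s, ∑ a, π s a = 1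

theorem stmt7 [Fintype S] [Fintype A] [Nonempty S] [Nonempty A]
    (πE : S → A → ℝ) (hπE : IsPolicy πE)
    (Q : S → A → ℝ) (V : S → ℝ) (hV : ∀ s, V s = ∑ a, πE s a * Q s a) :
    ((∀ s a, 0 < πE s a → Q s a = V s) ∧ (∀ s a, πE s a = 0 → Q s a ≤ V s)) ↔
      ∃ ζ : S → A → ℝ, (∀ s a, 0 ≤ ζ s a) ∧ ∃ W : S → ℝ,
        ∀ s a, Q s a = -(ζ s a * (if πE s a = 0 then 1 else 0)) + W s := by
  constructor
  · rintro ⟨hpos, hzero⟩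
    refine ⟨fun s a => |V s - Q s a|, fun s a => abs_nonneg _, V, fun s a => ?_⟩
    by_cases h : πE s a = 0
    · simp [h, abs_of_nonneg (sub_nonneg.mpr (hzero s a h))]
    · simp [h, hpos s a (lt_of_le_of_ne (hπE.1 s a) (Ne.symm h))]
  · rintro ⟨ζ, hζ, W, hQ⟩
    have hVW : ∀ s, V s = W s := fun s => by
      have hterm : ∀ a, πE s a * Q s a = πE s a * W s := fun a => by
        by_cases h : πE s a = 0 <;> simp [h, hQ s a]
      simp only [hV, hterm, ← Finset.sum_mul, hπE.2 s, one_mul]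
    refine ⟨fun s a h => ?_, fun s a h => ?_⟩
    · simp [hQ s a, hVW, h.ne']
    · simp [hQ s a, hVW, h, hζ s a]

end Stmt7
end
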